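/- arXiv:2408.11725 — 2 statements merged into one kernel-verified Lean document; each statement's English description precedes it below -/
import Mathlib

section
/- Let P_1, …, P_N be Markov kernels on a measurable space (X, ℬ) and let π be a probability measure invariant for each P_i. Suppose there exist an integer m ≥ 1, δ ∈ (0,1], and a probability measure ν on (X, ℬ) such that P_GS^m(x,A) ≥ δ ν(A) for all x ∈ X and A ∈ ℬ, where P_GS = P_1 P_2 ⋯ P_N. Then for every ε > 0, every q ∈ [ε,1]^N, and every n ≥ 0: sup_{x∈X} ‖P_q^n(x,·) − π‖_TV ≤ (1 − ε^{Nm} δ)^{⌊n/m⌋} (a quantitative form of Proposition 3.1, uniform in q over [ε,1]^N). -/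
open MeasureTheory ProbabilityTheory Filter
open scoped ENNReal

/-- Total variation distance between two measures:
`‖μ − ν‖_TV = sup_{A ∈ ℬ} |μ(A) − ν(A)|`. -/
noncomputable def tvDist {X : Type*} [MeasurableSpace X] (μ ν : Measure X) : ℝ :=
  ⨆ A : {s : Set X // MeasurableSet s}, |(μ A.1).toReal - (ν A.1).toReal|

/-- `n`-fold composition of a kernel with itself (`kpow P 0` is the identity kernel).
Recall `η ∘ₖ κ` applies `κ` first and then `η`. -/
noncomputable def kpow {X : Type*} [MeasurableSpace X] (P : Kernel X X) : ℕ → Kernel X X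
  | 0 => Kernel.id
  | n + 1 => kpow P n ∘ₖ P

/-- Composition of a list of kernels, applying them in the order of the list. -/
noncomputable def seqComp {X : Type*} [MeasurableSpace X] (l : List (Kernel X X)) : Kernel X X :=
  l.foldl (fun acc κ => κ ∘ₖ acc) Kernel.id

/-- The composed kernel `P_S` for a subset `S ⊆ {1,…,N}`, applying the kernels of `S` in
increasing index order. -/
noncomputable def subsetComp {X : Type*} [MeasurableSpace X] {N : ℕ}
    (P : Fin N → Kernel X X) (S : Finset (Fin N)) : Kernel X X :=
  seqComp ((S.sort (· ≤ ·)).map P)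

/-- The systematic-scan (Gibbs) kernel `P_GS = P_1 P_2 ⋯ P_N`. -/
noncomputable def gsKernel {X : Type*} [MeasurableSpace X] {N : ℕ}
    (P : Fin N → Kernel X X) : Kernel X X :=
  subsetComp P Finset.univ

/-- Selection weight `w_S(q)` of a nonempty subset `S` in the multiple random-scan scheme:
`w_S(q) = (∏_{i∈S} q_i ∏_{i∉S} (1 − q_i)) / (1 − ∏_i (1 − q_i))`. -/
noncomputable def selWeight {N : ℕ} (q : Fin N → ℝ) (S : Finset (Fin N)) : ℝ :=
  ((∏ i ∈ S, q i) * ∏ i ∈ Sᶜ, (1 - q i)) / (1 - ∏ i, (1 - q i))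

/-- Scalar multiple of a kernel by an extended nonnegative real. -/
noncomputable def kSMul {X : Type*} [MeasurableSpace X] (c : ℝ≥0∞) (κ : Kernel X X) :
    Kernel X X :=
  ⟨fun x => c • κ x, Measure.measurable_of_measurable_coe _ (fun s hs => by
    simp_rw [Measure.smul_apply, smul_eq_mul]
    exact (κ.measurable_coe hs).const_mul c)⟩

/-- The multiple random-scan kernel `P_q = Σ_{∅≠S⊆{1,…,N}} w_S(q) P_S`. -/
noncomputable def mrsKernel {X : Type*} [MeasurableSpace X] {N : ℕ}
    (P : Fin N → Kernel X X) (q : Fin N → ℝ) : Kernel X X :=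
  ∑ S ∈ Finset.univ.filter (fun S : Finset (Fin N) => S.Nonempty),
    kSMul (ENNReal.ofReal (selWeight q S)) (subsetComp P S)

/-- The single-coordinate random-scan kernel `P_p = Σ_{i=1}^N p_i P_i`. -/
noncomputable def rsKernel {X : Type*} [MeasurableSpace X] {N : ℕ}
    (P : Fin N → Kernel X X) (p : Fin N → ℝ) : Kernel X X :=
  ∑ i : Fin N, kSMul (ENNReal.ofReal (p i)) (P i)

/-- The Dobrushin contraction coefficient `β(P) = sup_{x,y} ‖P(x,·) − P(y,·)‖_TV`. -/
noncomputable def dobrushin {X : Type*} [MeasurableSpace X] (P : Kernel X X) : ℝ :=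
  ⨆ x : X, ⨆ y : X, tvDist (P x) (P y)

/-- A kernel `P` with target probability measure `π` is uniformly ergodic if
`sup_x ‖P^n(x,·) − π‖_TV ≤ M ρ^n` for some `M ≥ 0` and `ρ ∈ [0,1)` and all `n ≥ 1`. -/
def UniformlyErgodic {X : Type*} [MeasurableSpace X] (P : Kernel X X) (π : Measure X) : Prop :=
  ∃ M ρ : ℝ, 0 ≤ M ∧ 0 ≤ ρ ∧ ρ < 1 ∧
    ∀ n : ℕ, 1 ≤ n → ∀ x : X, tvDist (kpow P n x) π ≤ M * ρ ^ n

section MarkovKernels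

variable {X : Type*} [MeasurableSpace X]

lemma isMarkovKernel_kpow (Q : Kernel X X) [IsMarkovKernel Q] (n : ℕ) :
    IsMarkovKernel (kpow Q n) := by
  induction n with
  | zero => rw [kpow]; infer_instance
  | succ n ih => rw [kpow]; infer_instance

lemma kpow_add (Q : Kernel X X) (n m : ℕ) : kpow Q (n + m) = kpow Q n ∘ₖ kpow Q m := by
  induction m with
  | zero => simp [kpow]
  | succ m ih => rw [← add_assoc, kpow, ih, kpow, Kernel.comp_assoc]

lemma invariant_kpow {Q : Kernel X X} {π : Measure X} (h : Kernel.Invariant Q π) (n : ℕ) :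
    Kernel.Invariant (kpow Q n) π := by
  induction n with
  | zero => exact Measure.bind_dirac
  | succ n ih => exact ih.comp h

lemma smul_kpow_le_kpow {Q R : Kernel X X} {c : ℝ≥0∞} (h : ∀ x, c • R x ≤ Q x) (n : ℕ) (x : X) :
    c ^ n • kpow R n x ≤ kpow Q n x := by
  induction n generalizing x with
  | zero => simp [kpow]
  | succ n ih =>
    refine Measure.le_iff.2 fun A hA => ?_
    rw [Measure.smul_apply, kpow, kpow, Kernel.comp_apply' _ _ _ hA, Kernel.comp_apply' _ _ _ hA]
    calc c ^ (n + 1) * ∫⁻ y, kpow R n y A ∂(R x)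
        = ∫⁻ y, c ^ n * kpow R n y A ∂(c • R x) := by
          rw [lintegral_smul_measure, lintegral_const_mul _ (Kernel.measurable_coe _ hA),
            smul_eq_mul, ← mul_assoc, pow_succ']
      _ ≤ ∫⁻ y, kpow Q n y A ∂(Q x) :=
          lintegral_mono' (h x) fun y => ih y A

lemma seqComp_induction {p : Kernel X X → Prop} (hid : p Kernel.id)
    (hcomp : ∀ η κ, p η → p κ → p (η ∘ₖ κ)) (l : List (Kernel X X)) (hl : ∀ κ ∈ l, p κ) :
    p (seqComp l) := by
  suffices ∀ κ, p κ → p (l.foldl (fun acc κ => κ ∘ₖ acc) κ) from this _ hid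
  induction l with
  | nil => exact fun κ hκ => hκ
  | cons η l ih =>
    exact fun κ hκ => ih (fun κ' h => hl κ' (List.mem_cons_of_mem _ h)) _
      (hcomp η κ (hl η List.mem_cons_self) hκ)

lemma subsetComp_induction {N : ℕ} {p : Kernel X X → Prop} (hid : p Kernel.id)
    (hcomp : ∀ η κ, p η → p κ → p (η ∘ₖ κ)) {P : Fin N → Kernel X X} (hP : ∀ i, p (P i))
    (S : Finset (Fin N)) : p (subsetComp P S) := by
  refine seqComp_induction hid hcomp _ fun κ hκ => ?_
  obtain ⟨i, -, rfl⟩ := List.mem_map.1 hκ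
  exact hP i

lemma isMarkovKernel_subsetComp {N : ℕ} {P : Fin N → Kernel X X}
    (hP : ∀ i, IsMarkovKernel (P i)) (S : Finset (Fin N)) : IsMarkovKernel (subsetComp P S) :=
  subsetComp_induction (p := fun κ => IsMarkovKernel κ) inferInstance
    (fun _ _ _ _ => inferInstance) hP S

lemma invariant_subsetComp {N : ℕ} {P : Fin N → Kernel X X} {π : Measure X}
    (hinv : ∀ i, Kernel.Invariant (P i) π) (S : Finset (Fin N)) :
    Kernel.Invariant (subsetComp P S) π :=
  subsetComp_induction (p := fun κ => Kernel.Invariant κ π) Measure.bind_dirac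
    (fun _ _ h₁ h₂ => h₁.comp h₂) hinv S

lemma mrsKernel_apply {N : ℕ} (P : Fin N → Kernel X X) (q : Fin N → ℝ) (x : X) (A : Set X) :
    mrsKernel P q x A = ∑ S ∈ Finset.univ.filter (fun S : Finset (Fin N) => S.Nonempty),
      ENNReal.ofReal (selWeight q S) * subsetComp P S x A := by
  rw [mrsKernel, Kernel.finsetSum_apply']
  rfl

/-- The integral of `f` against `μ ≥ c ν` lies in an interval obtained by shrinking the range
of `f` by the factor `1 - c`. -/
lemma integral_mem_Icc_of_smul_le {μ ν : Measure X} [IsProbabilityMeasure μ]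
    [IsProbabilityMeasure ν] {c : ℝ} (hc : 0 ≤ c) (h : ENNReal.ofReal c • ν ≤ μ)
    {f : X → ℝ} (hf : Measurable f) {a b : ℝ} (hab : ∀ y, f y ∈ Set.Icc a b) :
    ∫ y, f y ∂μ ∈ Set.Icc (c * ∫ y, f y ∂ν + (1 - c) * a) (c * ∫ y, f y ∂ν + (1 - c) * b) := by
  have hint : ∀ ρ : Measure X, IsFiniteMeasure ρ → Integrable f ρ := fun ρ _ =>
    Integrable.of_mem_Icc a b hf.aemeasurable (.of_forall hab)
  have hlower : c * ∫ y, (f y - a) ∂ν ≤ ∫ y, (f y - a) ∂μ := by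
    have := integral_mono_measure h (f := fun y => f y - a)
      (.of_forall fun y => sub_nonneg.2 (hab y).1) ((hint μ inferInstance).sub (integrable_const a))
    rwa [integral_smul_measure, ENNReal.toReal_ofReal hc] at this
  have hupper : c * ∫ y, (b - f y) ∂ν ≤ ∫ y, (b - f y) ∂μ := by
    have := integral_mono_measure h (f := fun y => b - f y)
      (.of_forall fun y => sub_nonneg.2 (hab y).2)
      ((integrable_const b).sub (hint μ inferInstance))
    rwa [integral_smul_measure, ENNReal.toReal_ofReal hc] at this
  rw [integral_sub (hint _ inferInstance) (integrable_const a),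
    integral_sub (hint _ inferInstance) (integrable_const a)] at hlower
  rw [integral_sub (integrable_const b) (hint _ inferInstance),
    integral_sub (integrable_const b) (hint _ inferInstance)] at hupper
  simp only [integral_const, probReal_univ, one_smul] at hlower hupper
  constructor <;> linarith

lemma real_bind_apply {Q : Kernel X X} [IsMarkovKernel Q] {μ : Measure X} {A : Set X}
    (hA : MeasurableSet A) : (μ.bind Q).real A = ∫ y, (Q y).real A ∂μ := by
  rw [measureReal_def, Measure.bind_apply hA Q.aemeasurable]
  exact (integral_toReal (Q.measurable_coe hA).aemeasurable
    (.of_forall fun y => measure_lt_top _ _)).symm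

/-- Doeblin's condition at time `m` makes the oscillation of `x ↦ Q ^ n (x, A)` decay
geometrically. -/
lemma exists_kpow_mem_Icc {Q : Kernel X X} [IsMarkovKernel Q] {ν : Measure X}
    [IsProbabilityMeasure ν] {c : ℝ} (hc : 0 ≤ c) {m : ℕ}
    (h : ∀ x, ENNReal.ofReal c • ν ≤ kpow Q m x) {A : Set X} (hA : MeasurableSet A) (r k : ℕ) :
    ∃ a b, b - a = (1 - c) ^ k ∧ ∀ x, (kpow Q (r + m * k) x).real A ∈ Set.Icc a b := by
  induction k with
  | zero =>
    have := isMarkovKernel_kpow Q (r + m * 0)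
    exact ⟨0, 1, by simp, fun x => ⟨measureReal_nonneg, measureReal_le_one⟩⟩
  | succ k ih =>
    obtain ⟨a, b, hlen, hmem⟩ := ih
    have := isMarkovKernel_kpow Q m
    have := isMarkovKernel_kpow Q (r + m * k)
    refine ⟨c * ∫ y, (kpow Q (r + m * k) y).real A ∂ν + (1 - c) * a,
      c * ∫ y, (kpow Q (r + m * k) y).real A ∂ν + (1 - c) * b, ?_, fun x => ?_⟩
    · rw [pow_succ, ← hlen]; ring
    · rw [mul_add_one, ← add_assoc, kpow_add Q (r + m * k) m, Kernel.comp_apply, real_bind_apply hA]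
      exact integral_mem_Icc_of_smul_le hc (h x) (Kernel.measurable_coe _ hA).ennreal_toReal hmem

/-- Doeblin's theorem: geometric convergence in total variation under an `m`-step minorization. -/
theorem tvDist_kpow_le_of_minorization {Q : Kernel X X} [IsMarkovKernel Q] {π ν : Measure X}
    [IsProbabilityMeasure π] [IsProbabilityMeasure ν] (hinv : Kernel.Invariant Q π)
    {c : ℝ} (hc : 0 ≤ c) {m : ℕ} (h : ∀ x, ENNReal.ofReal c • ν ≤ kpow Q m x) (n : ℕ) (x : X) :
    tvDist (kpow Q n x) π ≤ (1 - c) ^ (n / m) := by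
  have : Nonempty {s : Set X // MeasurableSet s} := ⟨⟨∅, .empty⟩⟩
  refine ciSup_le fun ⟨A, hA⟩ => ?_
  obtain ⟨a, b, hlen, hmem⟩ := exists_kpow_mem_Icc hc h hA (n % m) (n / m)
  rw [Nat.mod_add_div] at hmem
  have := isMarkovKernel_kpow Q n
  have hπ : π.real A ∈ Set.Icc a b := by
    have := integral_mem_Icc_of_smul_le (μ := π) (ν := π) le_rfl (by simp [Measure.zero_le])
      (Kernel.measurable_coe (kpow Q n) hA).ennreal_toReal hmem
    have hbind := real_bind_apply (Q := kpow Q n) (μ := π) hA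
    rw [invariant_kpow hinv n] at hbind
    rw [hbind]
    simpa [measureReal_def] using this
  rw [← hlen]
  exact abs_sub_le_of_le_of_le (hmem x).1 (hmem x).2 hπ.1 hπ.2

end MarkovKernels

section SelectionWeights

variable {N : ℕ} {q : Fin N → ℝ}

lemma selWeight_nonneg (h0 : ∀ i, 0 ≤ q i) (h1 : ∀ i, q i ≤ 1) (S : Finset (Fin N)) :
    0 ≤ selWeight q S := by
  refine div_nonneg (mul_nonneg (Finset.prod_nonneg fun i _ => h0 i)
    (Finset.prod_nonneg fun i _ => sub_nonneg.2 (h1 i))) (sub_nonneg.2 ?_)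
  exact Finset.prod_le_one (fun i _ => sub_nonneg.2 (h1 i)) fun i _ => by linarith [h0 i]

lemma prod_one_sub_lt_one (hN : 1 ≤ N) (h0 : ∀ i, 0 < q i) (h1 : ∀ i, q i ≤ 1) :
    ∏ i, (1 - q i) < 1 := by
  let j : Fin N := ⟨0, hN⟩
  rw [← Finset.mul_prod_erase _ _ (Finset.mem_univ j)]
  have hle : ∏ i ∈ Finset.univ.erase j, (1 - q i) ≤ 1 :=
    Finset.prod_le_one (fun i _ => sub_nonneg.2 (h1 i)) fun i _ => by linarith [h0 i]
  nlinarith [h0 j, h1 j]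

lemma sum_selWeight (hN : 1 ≤ N) (h0 : ∀ i, 0 < q i) (h1 : ∀ i, q i ≤ 1) :
    ∑ S ∈ Finset.univ.filter (fun S : Finset (Fin N) => S.Nonempty), selWeight q S = 1 := by
  have hsum : ∑ S : Finset (Fin N), (∏ i ∈ S, q i) * ∏ i ∈ Sᶜ, (1 - q i) = 1 := by
    have := Finset.prod_add q (fun i => 1 - q i) Finset.univ
    simpa [Finset.compl_eq_univ_sdiff] using this.symm
  have hfilter : Finset.univ.filter (fun S : Finset (Fin N) => S.Nonempty)
      = Finset.univ.erase ∅ := by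
    ext S; simp [Finset.nonempty_iff_ne_empty]
  rw [← Finset.add_sum_erase _ _ (Finset.mem_univ (∅ : Finset (Fin N)))] at hsum
  simp only [Finset.prod_empty, Finset.compl_empty, one_mul] at hsum
  simp only [selWeight]
  rw [hfilter, ← Finset.sum_div, ← eq_sub_of_add_eq' hsum]
  refine div_self fun h => ?_
  linarith [prod_one_sub_lt_one hN h0 h1]

lemma pow_le_selWeight_univ (hN : 1 ≤ N) {ε : ℝ} (hε : 0 < ε) (hq : ∀ i, ε ≤ q i ∧ q i ≤ 1) :
    ε ^ N ≤ selWeight q Finset.univ := by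
  have hlt := prod_one_sub_lt_one hN (fun i => hε.trans_le (hq i).1) fun i => (hq i).2
  have hnn : 0 ≤ ∏ i, (1 - q i) := Finset.prod_nonneg fun i _ => sub_nonneg.2 (hq i).2
  have hpow : ε ^ N ≤ ∏ i, q i := by
    simpa using Finset.prod_le_prod (s := Finset.univ) (fun _ _ => hε.le) fun i _ => (hq i).1
  simp only [selWeight, Finset.compl_univ, Finset.prod_empty, mul_one]
  rw [le_div_iff₀ (by linarith)]
  exact (mul_le_of_le_one_right (by positivity) (by linarith)).trans hpow

lemma sum_ofReal_selWeight (hN : 1 ≤ N) (h0 : ∀ i, 0 < q i) (h1 : ∀ i, q i ≤ 1) :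
    ∑ S ∈ Finset.univ.filter (fun S : Finset (Fin N) => S.Nonempty),
      ENNReal.ofReal (selWeight q S) = 1 := by
  rw [← ENNReal.ofReal_sum_of_nonneg fun S _ => selWeight_nonneg (fun i => (h0 i).le) h1 S,
    sum_selWeight hN h0 h1, ENNReal.ofReal_one]

end SelectionWeights

section MultipleRandomScan

variable {X : Type*} [MeasurableSpace X] {N : ℕ} {q : Fin N → ℝ} {P : Fin N → Kernel X X}

lemma isMarkovKernel_mrsKernel (hN : 1 ≤ N) (hP : ∀ i, IsMarkovKernel (P i))
    (h0 : ∀ i, 0 < q i) (h1 : ∀ i, q i ≤ 1) : IsMarkovKernel (mrsKernel P q) := by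
  have := isMarkovKernel_subsetComp hP
  refine ⟨fun x => ⟨?_⟩⟩
  simp [mrsKernel_apply, sum_ofReal_selWeight hN h0 h1]

lemma invariant_mrsKernel (hN : 1 ≤ N) {π : Measure X} (hinv : ∀ i, Kernel.Invariant (P i) π)
    (h0 : ∀ i, 0 < q i) (h1 : ∀ i, q i ≤ 1) : Kernel.Invariant (mrsKernel P q) π := by
  refine Measure.ext fun A hA => ?_
  rw [Measure.bind_apply hA (Kernel.aemeasurable _)]
  simp_rw [mrsKernel_apply]
  rw [lintegral_finsetSum _ fun S _ => (Kernel.measurable_coe _ hA).const_mul _]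
  have hS : ∀ S, ∫⁻ x, subsetComp P S x A ∂π = π A := fun S => by
    rw [← Measure.bind_apply hA (Kernel.aemeasurable _), invariant_subsetComp hinv S]
  simp_rw [lintegral_const_mul _ (Kernel.measurable_coe _ hA), hS]
  rw [← Finset.sum_mul, sum_ofReal_selWeight hN h0 h1, one_mul]

lemma smul_gsKernel_le_mrsKernel (hN : 1 ≤ N) {ε : ℝ} (hε : 0 < ε)
    (hq : ∀ i, ε ≤ q i ∧ q i ≤ 1) (x : X) :
    ENNReal.ofReal (ε ^ N) • gsKernel P x ≤ mrsKernel P q x := by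
  refine Measure.le_iff.2 fun A _ => ?_
  have huniv : Finset.univ ∈ Finset.univ.filter (fun S : Finset (Fin N) => S.Nonempty) := by
    simpa using ⟨⟨0, hN⟩, Finset.mem_univ _⟩
  rw [mrsKernel_apply, Measure.smul_apply, smul_eq_mul, gsKernel]
  calc ENNReal.ofReal (ε ^ N) * subsetComp P Finset.univ x A
      ≤ ENNReal.ofReal (selWeight q Finset.univ) * subsetComp P Finset.univ x A := by
        gcongr
        exact pow_le_selWeight_univ hN hε hq
    _ ≤ _ := Finset.single_le_sum
        (f := fun S => ENNReal.ofReal (selWeight q S) * subsetComp P S x A)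
        (fun _ _ => zero_le) huniv

end MultipleRandomScan

/-- quantitative Proposition 3.1. Under an `m`-step Doeblin
minorization `P_GS^m(x,A) ≥ δ ν(A)` and invariance of `π` for each `P_i`, for every
`ε > 0`, `q ∈ [ε,1]^N` and `n ≥ 0`:
`sup_x ‖P_q^n(x,·) − π‖_TV ≤ (1 − ε^{Nm} δ)^{⌊n/m⌋}`. -/
theorem mrs_uniform_ergodicity_quantitative
    {X : Type*} [MeasurableSpace X] {N : ℕ} (hN : 1 ≤ N)
    (P : Fin N → Kernel X X) (hP : ∀ i, IsMarkovKernel (P i))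
    (π : Measure X) [IsProbabilityMeasure π]
    (hinv : ∀ i, π.bind (P i) = π)
    (m : ℕ) (hm : 1 ≤ m) (δ : ℝ) (hδ0 : 0 < δ) (hδ1 : δ ≤ 1)
    (ν : Measure X) [IsProbabilityMeasure ν]
    (hminor : ∀ x : X, ∀ A : Set X, MeasurableSet A →
      ENNReal.ofReal δ * ν A ≤ kpow (gsKernel P) m x A) :
    ∀ ε : ℝ, 0 < ε → ∀ q : Fin N → ℝ, (∀ i, ε ≤ q i ∧ q i ≤ 1) →
      ∀ n : ℕ, ∀ x : X,
        tvDist (kpow (mrsKernel P q) n x) π ≤ (1 - ε ^ (N * m) * δ) ^ (n / m) := by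
  intro ε hε q hq n x
  have h0 : ∀ i, 0 < q i := fun i => hε.trans_le (hq i).1
  have h1 : ∀ i, q i ≤ 1 := fun i => (hq i).2
  have := isMarkovKernel_mrsKernel hN hP h0 h1
  refine tvDist_kpow_le_of_minorization (ν := ν) (invariant_mrsKernel hN hinv h0 h1)
    (by positivity) (fun y => Measure.le_iff.2 fun A hA => ?_) n x
  calc (ENNReal.ofReal (ε ^ (N * m) * δ) • ν) A
      = ENNReal.ofReal (ε ^ N) ^ m * (ENNReal.ofReal δ * ν A) := by
        rw [Measure.smul_apply, smul_eq_mul, ENNReal.ofReal_mul (by positivity), pow_mul,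
          ENNReal.ofReal_pow (by positivity), mul_assoc]
    _ ≤ ENNReal.ofReal (ε ^ N) ^ m * kpow (gsKernel P) m y A := by
        gcongr
        exact hminor y A hA
    _ ≤ kpow (mrsKernel P q) m y A :=
        smul_kpow_le_kpow (smul_gsKernel_le_mrsKernel hN hε hq) m y A
end

section
/- For a Markov kernel P on a measurable space (X, ℬ), define its Dobrushin contraction coefficient β(P) := sup_{x,y∈X} ‖P(x,·) − P(y,·)‖_TV. Then: (i) for all probability measures μ and μ' on (X, ℬ), ‖μP − μ'P‖_TV ≤ β(P) ‖μ − μ'‖_TV; and (ii) for any two Markov kernels P and Q on (X, ℬ), β(PQ) ≤ β(P) β(Q). -/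
open MeasureTheory ProbabilityTheory Filter
open scoped ENNReal

section TotalVariation

variable {X : Type*} [MeasurableSpace X]

lemma abs_measure_sub_le_one (μ ν : Measure X) [IsProbabilityMeasure μ] [IsProbabilityMeasure ν]
    (A : Set X) : |(μ A).toReal - (ν A).toReal| ≤ 1 := by
  have h₁ : (μ A).toReal ≤ 1 := measureReal_le_one
  have h₂ : (ν A).toReal ≤ 1 := measureReal_le_one
  have h₃ : 0 ≤ (μ A).toReal := ENNReal.toReal_nonneg
  have h₄ : 0 ≤ (ν A).toReal := ENNReal.toReal_nonneg
  rw [abs_le]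
  constructor <;> linarith

lemma tvDist_nonneg (μ ν : Measure X) : 0 ≤ tvDist μ ν :=
  Real.iSup_nonneg fun _ ↦ abs_nonneg _

lemma tvDist_comm (μ ν : Measure X) : tvDist μ ν = tvDist ν μ := by
  simp only [tvDist, abs_sub_comm]

lemma tvDist_le_one (μ ν : Measure X) [IsProbabilityMeasure μ] [IsProbabilityMeasure ν] :
    tvDist μ ν ≤ 1 :=
  Real.iSup_le (fun A ↦ abs_measure_sub_le_one μ ν A.1) zero_le_one

lemma measure_sub_le_tvDist (μ ν : Measure X) [IsProbabilityMeasure μ] [IsProbabilityMeasure ν]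
    {A : Set X} (hA : MeasurableSet A) : (μ A).toReal - (ν A).toReal ≤ tvDist μ ν := by
  have hbdd : BddAbove (Set.range fun A : {s : Set X // MeasurableSet s} ↦
      |(μ A.1).toReal - (ν A.1).toReal|) :=
    ⟨1, by rintro _ ⟨B, rfl⟩; exact abs_measure_sub_le_one μ ν B.1⟩
  exact (le_abs_self _).trans (le_ciSup hbdd ⟨A, hA⟩)

lemma dobrushin_nonneg (P : Kernel X X) : 0 ≤ dobrushin P :=
  Real.iSup_nonneg fun _ ↦ Real.iSup_nonneg fun _ ↦ tvDist_nonneg _ _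

lemma tvDist_le_dobrushin (P : Kernel X X) [IsMarkovKernel P] (x y : X) :
    tvDist (P x) (P y) ≤ dobrushin P := by
  have hy : ∀ x, BddAbove (Set.range fun y ↦ tvDist (P x) (P y)) := fun x ↦
    ⟨1, by rintro _ ⟨y, rfl⟩; exact tvDist_le_one _ _⟩
  have hx : BddAbove (Set.range fun x ↦ ⨆ y, tvDist (P x) (P y)) :=
    ⟨1, by rintro _ ⟨x, rfl⟩; exact Real.iSup_le (fun y ↦ tvDist_le_one _ _) zero_le_one⟩
  exact (le_ciSup (hy x) y).trans (le_ciSup hx x)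

/-- The integral of a function with values in `[m, m + b]` varies by at most `b` times the
total variation distance. -/
lemma integral_sub_integral_le_mul_tvDist (μ ν : Measure X) [IsProbabilityMeasure μ]
    [IsProbabilityMeasure ν] {f : X → ℝ} (hf : Measurable f) {m b : ℝ} (hb : 0 ≤ b)
    (hm : ∀ x, m ≤ f x) (hM : ∀ x, f x ≤ m + b) :
    ∫ x, f x ∂μ - ∫ x, f x ∂ν ≤ b * tvDist μ ν := by
  have hint : ∀ (ρ : Measure X) [IsFiniteMeasure ρ], Integrable f ρ := fun ρ _ ↦
    Integrable.of_mem_Icc m (m + b) hf.aemeasurable (.of_forall fun x ↦ ⟨hm x, hM x⟩)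
  obtain ⟨s, hs⟩ := exists_isHahnDecomposition ν μ
  have hsm := hs.measurableSet
  have h₁ : ∫ x in s, (m + b - f x) ∂ν ≤ ∫ x in s, (m + b - f x) ∂μ :=
    integral_mono_measure hs.le_on (.of_forall fun x ↦ sub_nonneg.2 (hM x))
      ((integrable_const _).sub (hint _))
  have h₂ : ∫ x in sᶜ, (f x - m) ∂μ ≤ ∫ x in sᶜ, (f x - m) ∂ν :=
    integral_mono_measure hs.ge_on_compl (.of_forall fun x ↦ sub_nonneg.2 (hm x))
      ((hint _).sub (integrable_const _))
  simp only [integral_sub (integrable_const _) (hint _), integral_sub (hint _) (integrable_const _),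
    setIntegral_const, smul_eq_mul, probReal_compl_eq_one_sub hsm] at h₁ h₂
  have h₃ : μ.real s - ν.real s ≤ tvDist μ ν := measure_sub_le_tvDist μ ν hsm
  rw [← integral_add_compl hsm (hint μ), ← integral_add_compl hsm (hint ν)]
  linarith [mul_le_mul_of_nonneg_left h₃ hb]

lemma bind_sub_bind_le (P : Kernel X X) [IsMarkovKernel P] (μ ν : Measure X)
    [IsProbabilityMeasure μ] [IsProbabilityMeasure ν] {A : Set X} (hA : MeasurableSet A) :
    (μ.bind P A).toReal - (ν.bind P A).toReal ≤ dobrushin P * tvDist μ ν := by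
  have hbind : ∀ ρ : Measure X, (ρ.bind P A).toReal = ∫ x, (P x A).toReal ∂ρ := fun ρ ↦ by
    rw [Measure.bind_apply hA P.measurable.aemeasurable,
      integral_toReal (P.measurable_coe hA).aemeasurable (.of_forall fun x ↦ measure_lt_top _ _)]
  have : Nonempty X := nonempty_of_isProbabilityMeasure μ
  rw [hbind, hbind]
  refine integral_sub_integral_le_mul_tvDist μ ν (P.measurable_coe hA).ennreal_toReal
    (m := ⨅ x, (P x A).toReal) (dobrushin_nonneg P) (fun x ↦ ?_) fun x ↦ ?_
  · exact ciInf_le ⟨0, by rintro _ ⟨y, rfl⟩; exact ENNReal.toReal_nonneg⟩ x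
  · rw [← sub_le_iff_le_add]
    refine le_ciInf fun y ↦ ?_
    linarith [measure_sub_le_tvDist (P x) (P y) hA, tvDist_le_dobrushin P x y]

lemma tvDist_bind_le (P : Kernel X X) [IsMarkovKernel P] (μ ν : Measure X)
    [IsProbabilityMeasure μ] [IsProbabilityMeasure ν] :
    tvDist (μ.bind P) (ν.bind P) ≤ dobrushin P * tvDist μ ν := by
  refine Real.iSup_le (fun A ↦ abs_le.2 ⟨?_, bind_sub_bind_le P μ ν A.2⟩)
    (mul_nonneg (dobrushin_nonneg P) (tvDist_nonneg μ ν))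
  have := bind_sub_bind_le P ν μ A.2
  rw [tvDist_comm] at this
  linarith

end TotalVariation

/-- Dobrushin contraction coefficient. (i) For all probability
measures `μ, μ'`: `‖μP − μ'P‖_TV ≤ β(P) ‖μ − μ'‖_TV`; (ii) for Markov kernels `P, Q`:
`β(PQ) ≤ β(P) β(Q)` (here `PQ` applies `P` first, i.e. it is `Q ∘ₖ P`). -/
theorem dobrushin_coefficient_properties
    {X : Type*} [MeasurableSpace X]
    (P Q : Kernel X X) (hP : IsMarkovKernel P) (hQ : IsMarkovKernel Q) :
    (∀ μ μ' : Measure X, IsProbabilityMeasure μ → IsProbabilityMeasure μ' →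
      tvDist (μ.bind P) (μ'.bind P) ≤ dobrushin P * tvDist μ μ') ∧
    dobrushin (Q ∘ₖ P) ≤ dobrushin P * dobrushin Q := by
  refine ⟨fun μ μ' _ _ ↦ tvDist_bind_le P μ μ', ?_⟩
  have hPQ := mul_nonneg (dobrushin_nonneg P) (dobrushin_nonneg Q)
  refine Real.iSup_le (fun x ↦ Real.iSup_le (fun y ↦ ?_) hPQ) hPQ
  rw [Kernel.comp_apply, Kernel.comp_apply, mul_comm]
  exact (tvDist_bind_le Q (P x) (P y)).trans
    (mul_le_mul_of_nonneg_left (tvDist_le_dobrushin P x y) (dobrushin_nonneg Q))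
end
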